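/- Stability of the L² projection in the dG seminorm: with the dG setup below, there exists a constant C > 0 depending only on q (and not on the partition; the paper obtains C = 3) such that for every function w : [0,1] → ℝ that is continuously differentiable on each closed cell I_n, one has |P_q[w]|_dG² ≤ C |w|_dG², where P_q[w] ∈ V_q is the L²(0,1)-orthogonal projection of w onto V_q. -/

import Mathlib

open scoped BigOperators
open MeasureTheory Set

namespace DG

noncomputable def pev (q : ℕ) (c : ℕ → ℕ → ℝ) (n : ℕ) (y : ℝ) : ℝ :=
  ∑ k ∈ Finset.range (q + 1), c n k * y ^ k

noncomputable def pev' (q : ℕ) (c : ℕ → ℕ → ℝ) (n : ℕ) (y : ℝ) : ℝ :=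
  ∑ k ∈ Finset.range (q + 1), (k : ℝ) * c n k * y ^ (k - 1)

noncomputable def inner2 (q N : ℕ) (x : ℕ → ℝ) (c d : ℕ → ℕ → ℝ) : ℝ :=
  ∑ n ∈ Finset.range N, ∫ y in (x n)..(x (n + 1)), pev q c n y * pev q d n y

noncomputable def nsq (q N : ℕ) (x : ℕ → ℝ) (c : ℕ → ℕ → ℝ) : ℝ :=
  inner2 q N x c c

noncomputable def intg (q N : ℕ) (x : ℕ → ℝ) (c : ℕ → ℕ → ℝ) : ℝ :=
  ∑ n ∈ Finset.range N, ∫ y in (x n)..(x (n + 1)), pev q c n y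

noncomputable def valR (q : ℕ) (x : ℕ → ℝ) (c : ℕ → ℕ → ℝ) (n : ℕ) : ℝ :=
  pev q c n (x n)

noncomputable def valL (q N : ℕ) (x : ℕ → ℝ) (c : ℕ → ℕ → ℝ) (n : ℕ) : ℝ :=
  if n = 0 then pev q c (N - 1) (x N) else pev q c (n - 1) (x n)

noncomputable def jmp (q N : ℕ) (x : ℕ → ℝ) (c : ℕ → ℕ → ℝ) (n : ℕ) : ℝ :=
  valL q N x c n - valR q x c n

noncomputable def Bm (q N : ℕ) (x : ℕ → ℝ) (w Ψ : ℕ → ℕ → ℝ) : ℝ :=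
  (∑ n ∈ Finset.range N, ∫ y in (x n)..(x (n + 1)), pev' q w n y * pev q Ψ n y)
    - ∑ n ∈ Finset.range N, jmp q N x w n * valL q N x Ψ n

noncomputable def Bp (q N : ℕ) (x : ℕ → ℝ) (w Ψ : ℕ → ℕ → ℝ) : ℝ :=
  (∑ n ∈ Finset.range N, ∫ y in (x n)..(x (n + 1)), pev' q w n y * pev q Ψ n y)
    - ∑ n ∈ Finset.range N, jmp q N x w n * valR q x Ψ n

def IsGminus (q N : ℕ) (x : ℕ → ℝ) (w g : ℕ → ℕ → ℝ) : Prop :=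
  ∀ Ψ : ℕ → ℕ → ℝ, inner2 q N x g Ψ = Bm q N x w Ψ

def IsGplus (q N : ℕ) (x : ℕ → ℝ) (w g : ℕ → ℕ → ℝ) : Prop :=
  ∀ Ψ : ℕ → ℕ → ℝ, inner2 q N x g Ψ = Bp q N x w Ψ

noncomputable def hseg (x : ℕ → ℝ) (n : ℕ) : ℝ := x (n + 1) - x n

noncomputable def hprev (N : ℕ) (x : ℕ → ℝ) (n : ℕ) : ℝ :=
  if n = 0 then hseg x (N - 1) else hseg x (n - 1)

noncomputable def dGsq (q N : ℕ) (x : ℕ → ℝ) (w : ℕ → ℕ → ℝ) : ℝ :=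
  ∑ n ∈ Finset.range N,
    ((∫ y in (x n)..(x (n + 1)), (pev' q w n y) ^ 2)
      + 2 * (jmp q N x w n) ^ 2 / (hprev N x n + hseg x n))

def Partition (N : ℕ) (x : ℕ → ℝ) : Prop :=
  2 ≤ N ∧ x 0 = 0 ∧ x N = 1 ∧ ∀ n < N, x n < x (n + 1)

def MeshRatio (N : ℕ) (x : ℕ → ℝ) (ρ : ℝ) : Prop :=
  ∀ n < N, hseg x n ≤ ρ * hseg x ((n + 1) % N) ∧ hseg x ((n + 1) % N) ≤ ρ * hseg x n

end DG

namespace DG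

/-- Jump at node n of a cellwise-defined function w : cell index → (ℝ → ℝ),
with the periodic convention w(x₀⁻) := w(x_N⁻). -/
noncomputable def jmpPC (N : ℕ) (x : ℕ → ℝ) (w : ℕ → ℝ → ℝ) (n : ℕ) : ℝ :=
  (if n = 0 then w (N - 1) (x N) else w (n - 1) (x n)) - w n (x n)

/-- Squared dG seminorm of a cellwise C¹ function, with the cellwise derivative
taken within the closed cell. -/
noncomputable def dGsqPC (N : ℕ) (x : ℕ → ℝ) (w : ℕ → ℝ → ℝ) : ℝ :=
  ∑ n ∈ Finset.range N,
    ((∫ y in (x n)..(x (n + 1)),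
        (derivWithin (w n) (Set.Icc (x n) (x (n + 1))) y) ^ 2)
      + 2 * (jmpPC N x w n) ^ 2 / (hprev N x n + hseg x n))

end DG

namespace DG

open Polynomial in
lemma ref_pos (q : ℕ) : ∃ δ > (0:ℝ), ∀ v : Fin (q+1) → ℝ,
    δ * ‖v‖^2 ≤ ∫ t in (0:ℝ)..1, (∑ i, v i * t ^ (i:ℕ))^2 := by
  have hcont : Continuous (fun v : Fin (q+1) → ℝ => ∫ t in (0:ℝ)..1, (∑ i, v i * t ^ (i:ℕ))^2) := by
    apply intervalIntegral.continuous_parametric_intervalIntegral_of_continuous'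
    simp only [Function.uncurry_def]
    fun_prop
  have hpos : ∀ v : Fin (q+1) → ℝ, v ≠ 0 → 0 < ∫ t in (0:ℝ)..1, (∑ i, v i * t ^ (i:ℕ))^2 := by
    intro v hv
    by_contra hneg
    apply hv
    let P : ℝ[X] := ∑ i : Fin (q+1), C (v i) * X ^ (i:ℕ)
    have hP : ∀ t, P.eval t = ∑ i, v i * t ^ (i:ℕ) := by
      intro t; simp [P, eval_finsetSum]
    have hz : ∀ t ∈ Icc (0:ℝ) 1, P.eval t = 0 := by
      intro t ht
      by_contra h
      apply hneg
      apply intervalIntegral.integral_pos (by norm_num)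
      · fun_prop
      · intro x _; positivity
      · refine ⟨t, ht, ?_⟩
        rw [← hP]; positivity
    have hP0 : P = 0 := by
      apply Polynomial.eq_zero_of_infinite_isRoot
      apply Set.Infinite.mono (s := Icc (0:ℝ) 1)
      · intro t ht; exact hz t ht
      · exact Set.Icc_infinite (by norm_num)
    funext i
    have := congrArg (fun p => p.coeff (i:ℕ)) hP0
    simp only [P, finsetSum_coeff, coeff_C_mul, coeff_X_pow, coeff_zero] at this
    rw [Finset.sum_eq_single i] at this
    · simpa using this
    · intro b _ hb
      have : (i:ℕ) ≠ b := fun h => hb (Fin.ext h.symm)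
      simp [this]
    · simp
  obtain ⟨v0, hv0, hmin⟩ := (isCompact_sphere (0 : Fin (q+1) → ℝ) 1).exists_isMinOn
    (NormedSpace.sphere_nonempty.2 zero_le_one) hcont.continuousOn
  have hv0' : v0 ≠ 0 := by
    rintro rfl; simp at hv0
  refine ⟨_, hpos v0 hv0', ?_⟩
  intro v
  by_cases hv : v = 0
  · subst hv; simp
  have hn : 0 < ‖v‖ := norm_pos_iff.2 hv
  have hm := hmin (show ‖v‖⁻¹ • v ∈ Metric.sphere 0 1 by
    simp [norm_smul, hn.ne'])
  simp only [mem_ofPred_eq] at hm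
  have e : (∫ t in (0:ℝ)..1, (∑ i, (‖v‖⁻¹ • v) i * t ^ (i:ℕ))^2)
      = (‖v‖⁻¹)^2 * ∫ t in (0:ℝ)..1, (∑ i, v i * t ^ (i:ℕ))^2 := by
    rw [← intervalIntegral.integral_const_mul]
    congr 1; funext t
    rw [← mul_pow, Finset.mul_sum]
    simp [mul_assoc]
  rw [e] at hm
  calc _ ≤ _ := mul_le_mul_of_nonneg_right hm (by positivity)
    _ = _ := by field_simp

open Polynomial in
lemma ref_inv (q : ℕ) : ∃ K > (0:ℝ), ∀ R : ℝ[X], R.natDegree ≤ q → ∀ t ∈ Icc (0:ℝ) 1,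
    (R.eval t)^2 ≤ K * (∫ s in (0:ℝ)..1, (R.eval s)^2) ∧
    (R.derivative.eval t)^2 ≤ K * (∫ s in (0:ℝ)..1, (R.eval s)^2) := by
  obtain ⟨δ, hδ, H⟩ := ref_pos q
  refine ⟨((q+1:ℝ)*(q+1))^2/δ, by positivity, ?_⟩
  intro R hR t ht
  let v : Fin (q+1) → ℝ := fun i => R.coeff i
  have hev : ∀ s, R.eval s = ∑ i, v i * s ^ (i:ℕ) := by
    intro s
    rw [eval_eq_sum_range' (n := q+1) (by omega), Finset.sum_range]
  have hder : R.derivative.eval t = ∑ i : Fin (q+1), (v i * (i:ℕ)) * t ^ ((i:ℕ)-1) := by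
    rw [derivative_eval, sum_over_range' R (fun n => by simp) (q+1) (by omega), Finset.sum_range]
  have hHv := H v
  simp_rw [← hev] at hHv
  have hc : ∀ i, |v i| ≤ ‖v‖ := fun i => by simpa using norm_le_pi_norm v i
  have key : ∀ u : ℝ, |u| ≤ (q+1)*(q+1)*‖v‖ →
      u^2 ≤ ((q+1:ℝ)*(q+1))^2/δ * (∫ s in (0:ℝ)..1, (R.eval s)^2) := by
    intro u hu
    have : u^2 ≤ ((q+1)*(q+1)*‖v‖)^2 := by
      rw [← sq_abs]; gcongr
    calc u^2 ≤ _ := this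
      _ = ((q+1:ℝ)*(q+1))^2/δ * (δ * ‖v‖^2) := by field_simp
      _ ≤ _ := by gcongr
  have tp : ∀ k : ℕ, |t^k| ≤ 1 := fun k => by
    rw [abs_of_nonneg (pow_nonneg ht.1 _)]; exact pow_le_one₀ ht.1 ht.2
  have hq0 : (0:ℝ) ≤ q := Nat.cast_nonneg q
  constructor
  · apply key
    rw [hev]
    calc _ ≤ ∑ i : Fin (q+1), |v i * t ^ (i:ℕ)| := Finset.abs_sum_le_sum_abs _ _
      _ ≤ ∑ i : Fin (q+1), ((q+1:ℝ) * ‖v‖) := by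
        apply Finset.sum_le_sum
        intro i _
        rw [abs_mul]
        calc |v i| * |t^(i:ℕ)| ≤ ‖v‖ * 1 := by gcongr; exacts [hc i, tp _]
          _ ≤ _ := by nlinarith [norm_nonneg v]
      _ = _ := by simp; ring
  · apply key
    rw [hder]
    calc _ ≤ ∑ i : Fin (q+1), |v i * (i:ℕ) * t ^ ((i:ℕ)-1)| := Finset.abs_sum_le_sum_abs _ _
      _ ≤ ∑ i : Fin (q+1), ((q+1:ℝ) * ‖v‖) := by
        apply Finset.sum_le_sum
        intro i _
        have hi : |((i:ℕ):ℝ)| ≤ q+1 := by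
          rw [abs_of_nonneg (Nat.cast_nonneg _)]
          exact_mod_cast i.2.le
        rw [abs_mul, abs_mul]
        calc |v i| * |((i:ℕ):ℝ)| * |t^((i:ℕ)-1)| ≤ ‖v‖ * (q+1) * 1 := by
              gcongr; exacts [hc i, tp _]
          _ = _ := by ring
      _ = _ := by simp; ring

open Polynomial in
lemma inv_ineq (q : ℕ) : ∃ K > (0:ℝ), ∀ R : ℝ[X], R.natDegree ≤ q → ∀ a b : ℝ, a < b →
    ∀ y ∈ Icc a b,
    (R.eval y)^2 * (b-a) ≤ K * (∫ s in a..b, (R.eval s)^2) ∧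
    (R.derivative.eval y)^2 * (b-a)^3 ≤ K * (∫ s in a..b, (R.eval s)^2) := by
  obtain ⟨K, hK, H⟩ := ref_inv q
  refine ⟨K, hK, ?_⟩
  intro R hR a b hab y hy
  have hh : 0 < b - a := by linarith
  let S : ℝ[X] := R.comp (C a + C (b-a) * X)
  have hS : S.natDegree ≤ q := by
    refine natDegree_comp_le.trans ?_
    have : (C a + C (b-a) * X : ℝ[X]).natDegree ≤ 1 := by
      compute_degree
    nlinarith
  have hSe : ∀ t, S.eval t = R.eval (a + (b-a)*t) := by intro t; simp [S]
  have hSd : ∀ t, S.derivative.eval t = (b-a) * R.derivative.eval (a + (b-a)*t) := by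
    intro t; simp [S, derivative_comp]
  let t := (y - a)/(b-a)
  have ht : t ∈ Icc (0:ℝ) 1 := by
    constructor
    · exact div_nonneg (by linarith [hy.1]) hh.le
    · rw [div_le_one hh]; linarith [hy.2]
  have hyt : a + (b-a)*t = y := by simp only [t]; field_simp; ring
  have hint : (∫ s in (0:ℝ)..1, (S.eval s)^2) * (b-a) = ∫ s in a..b, (R.eval s)^2 := by
    simp_rw [hSe]
    have := intervalIntegral.mul_integral_comp_add_mul (a := 0) (b := 1)
      (f := fun s => (R.eval s)^2) (b-a) a
    rw [mul_comm, this]; simp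
  obtain ⟨h1, h2⟩ := H S hS t ht
  rw [hSe, hyt] at h1
  rw [hSd, hyt] at h2
  rw [← hint]
  constructor
  · nlinarith
  · have := mul_le_mul_of_nonneg_right h2 hh.le
    nlinarith

lemma c1_bound (W : ℝ → ℝ) (a b : ℝ) (hab : a < b) (hW : ContDiffOn ℝ 1 W (Icc a b)) :
    ∀ y ∈ Icc a b, (W y - W a)^2 ≤ (b-a) * ∫ s in a..b, (derivWithin W (Icc a b) s)^2 := by
  intro y hy
  have hc : ContinuousOn (derivWithin W (Icc a b)) (Icc a b) :=
    hW.continuousOn_derivWithin (uniqueDiffOn_Icc hab) le_rfl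
  set g := derivWithin W (Icc a b) with hg
  have hsub : Icc a y ⊆ Icc a b := Icc_subset_Icc_right hy.2
  have hgi : IntervalIntegrable g volume a y :=
    (hc.mono hsub).intervalIntegrable_of_Icc hy.1
  have hgi2 : IntervalIntegrable (fun s => g s ^2) volume a y :=
    ((hc.mono hsub).pow 2).intervalIntegrable_of_Icc hy.1
  have hgib : IntervalIntegrable (fun s => g s ^2) volume a b :=
    (hc.pow 2).intervalIntegrable_of_Icc hab.le
  have hftc : ∫ s in a..y, g s = W y - W a := by
    apply intervalIntegral.integral_eq_sub_of_hasDerivAt_of_le hy.1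
      (hW.continuousOn.mono hsub) _ hgi
    intro s hs
    have hs' : s ∈ Icc a b := ⟨hs.1.le, hs.2.le.trans hy.2⟩
    have := ((hW.differentiableOn (by norm_num)) s hs').hasDerivWithinAt
    exact this.hasDerivAt (Icc_mem_nhds hs.1 (hs.2.trans_le hy.2))
  have hmono : ∫ s in a..y, g s ^2 ≤ ∫ s in a..b, g s^2 := by
    apply intervalIntegral.integral_mono_interval le_rfl hy.1 hy.2 _ hgib
    exact Filter.Eventually.of_forall fun s => sq_nonneg _
  have hD : 0 ≤ ∫ s in a..b, g s^2 :=
    intervalIntegral.integral_nonneg hab.le fun s _ => sq_nonneg _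
  rcases hy.1.eq_or_lt with h | h
  · subst h; simp only [sub_self]; nlinarith
  · have hl : 0 < y - a := by linarith
    set F := W y - W a
    have h0 : 0 ≤ ∫ s in a..y, (g s - F/(y-a))^2 :=
      intervalIntegral.integral_nonneg hy.1 fun s _ => sq_nonneg _
    have e : ∫ s in a..y, (g s - F/(y-a))^2
        = (∫ s in a..y, g s^2) - 2*(F/(y-a))*F + (F/(y-a))^2*(y-a) := by
      have : (fun s => (g s - F/(y-a))^2) =
        fun s => (g s ^2 - (2*(F/(y-a))) * g s) + (F/(y-a))^2 := by funext s; ring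
      rw [this, intervalIntegral.integral_add (hgi2.sub (hgi.const_mul _)) (by simp),
        intervalIntegral.integral_sub hgi2 (hgi.const_mul _),
        intervalIntegral.integral_const_mul, hftc]
      simp; ring
    rw [e] at h0
    have h1 : F^2/(y-a) ≤ ∫ s in a..y, g s^2 := by
      have : 2*(F/(y-a))*F - (F/(y-a))^2*(y-a) = F^2/(y-a) := by field_simp; ring
      linarith
    rw [div_le_iff₀ hl] at h1
    nlinarith [hy.2]

open Polynomial in
lemma cell (q : ℕ) : ∃ K > (0:ℝ), ∀ (W : ℝ → ℝ) (a b : ℝ), a < b →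
    ContDiffOn ℝ 1 W (Icc a b) → ∀ P : ℝ[X], P.natDegree ≤ q →
    (∀ Q : ℝ[X], Q.natDegree ≤ q → ∫ y in a..b, (P.eval y - W y) * Q.eval y = 0) →
    (∫ y in a..b, (P.derivative.eval y)^2)
        ≤ K * ∫ s in a..b, (derivWithin W (Icc a b) s)^2 ∧
    ∀ y ∈ Icc a b, (P.eval y - W y)^2
        ≤ K * ((b-a) * ∫ s in a..b, (derivWithin W (Icc a b) s)^2) := by
  obtain ⟨K, hK, H⟩ := inv_ineq q
  refine ⟨2*(K+1), by positivity, ?_⟩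
  intro W a b hab hW P hP horth
  have hh : 0 < b - a := by linarith
  have hF := c1_bound W a b hab hW
  set D := ∫ s in a..b, (derivWithin W (Icc a b) s)^2 with hDdef
  have hD : 0 ≤ D := intervalIntegral.integral_nonneg hab.le fun s _ => sq_nonneg _
  let R : ℝ[X] := P - C (W a)
  have hR : R.natDegree ≤ q := by
    simpa [R] using hP
  have hRe : ∀ y, R.eval y = P.eval y - W a := by intro y; simp [R]
  have hRd : R.derivative = P.derivative := by simp [R]
  have hWc : ContinuousOn (fun y => W y - W a) (Icc a b) := hW.continuousOn.sub continuousOn_const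
  have iF2 : IntervalIntegrable (fun y => (W y - W a)^2) volume a b :=
    (hWc.pow 2).intervalIntegrable_of_Icc hab.le
  have hRc : Continuous (fun y => R.eval y) := R.continuous
  have iR2 : IntervalIntegrable (fun y => (R.eval y)^2) volume a b :=
    (hRc.pow 2).intervalIntegrable _ _
  have iO : IntervalIntegrable (fun y => (P.eval y - W y) * R.eval y) volume a b :=
    ((P.continuous.continuousOn.sub hW.continuousOn).mul hRc.continuousOn).intervalIntegrable_of_Icc hab.le
  have h1 : ∫ y in a..b, (R.eval y)^2 ≤ ∫ y in a..b, (W y - W a)^2 := by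
    have h0 := horth R hR
    have hle : (∫ y in a..b, ((R.eval y)^2 - 2 * ((P.eval y - W y) * R.eval y)))
        ≤ ∫ y in a..b, (W y - W a)^2 := by
      apply intervalIntegral.integral_mono_on hab.le (iR2.sub (iO.const_mul 2)) iF2
      intro y _
      rw [hRe]
      nlinarith [sq_nonneg (P.eval y - W y)]
    rw [intervalIntegral.integral_sub iR2 (iO.const_mul 2),
      intervalIntegral.integral_const_mul, h0] at hle
    linarith
  have h2 : ∫ y in a..b, (W y - W a)^2 ≤ (b-a)*((b-a)*D) := by
    have := intervalIntegral.integral_mono_on hab.le iF2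
      (intervalIntegrable_const (c := (b-a)*D)) hF
    simpa using this
  have h3 := h1.trans h2
  constructor
  · have hpt : ∀ y ∈ Icc a b, (P.derivative.eval y)^2 ≤ K*D/(b-a) := by
      intro y hy
      have h4 := (H R hR a b hab y hy).2
      rw [hRd] at h4
      have h5 := h4.trans (mul_le_mul_of_nonneg_left h3 hK.le)
      rw [le_div_iff₀ hh]
      have h6 : (b-a)^2 * ((P.derivative.eval y)^2 * (b-a)) ≤ (b-a)^2 * (K*D) := by nlinarith
      exact le_of_mul_le_mul_left h6 (by positivity)
    have := intervalIntegral.integral_mono_on hab.le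
      ((P.derivative.continuous.pow 2).intervalIntegrable (μ := volume) a b)
      (intervalIntegrable_const (μ := volume) (c := K*D/(b-a))) hpt
    simp only [intervalIntegral.integral_const, smul_eq_mul] at this
    rw [mul_div_cancel₀ _ hh.ne'] at this
    refine le_trans (show _ ≤ K * D from this) ?_
    nlinarith [mul_nonneg hK.le hD]
  · intro y hy
    have h4 := (H R hR a b hab y hy).1
    have h5 := h4.trans (mul_le_mul_of_nonneg_left h3 hK.le)
    have h6 : (R.eval y)^2 ≤ K * ((b-a)*D) := by
      have : (b-a) * (R.eval y)^2 ≤ (b-a) * (K * ((b-a)*D)) := by nlinarith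
      exact le_of_mul_le_mul_left this hh
    have h7 := hF y hy
    have h8 : P.eval y - W y = R.eval y - (W y - W a) := by rw [hRe]; ring
    rw [h8]
    nlinarith [sq_nonneg (R.eval y + (W y - W a))]

open Polynomial in
noncomputable def cpoly (q : ℕ) (c : ℕ → ℕ → ℝ) (n : ℕ) : ℝ[X] :=
  ∑ k ∈ Finset.range (q+1), C (c n k) * X ^ k

open Polynomial in
lemma cpoly_deg (q : ℕ) (c : ℕ → ℕ → ℝ) (n : ℕ) : (cpoly q c n).natDegree ≤ q := by
  apply natDegree_sum_le_of_forall_le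
  intro k hk
  have := Finset.mem_range.1 hk
  exact (natDegree_C_mul_X_pow_le _ _).trans (by omega)

open Polynomial in
lemma cpoly_eval (q : ℕ) (c : ℕ → ℕ → ℝ) (n : ℕ) (y : ℝ) :
    (cpoly q c n).eval y = pev q c n y := by
  simp [cpoly, pev, eval_finsetSum]

open Polynomial in
lemma cpoly_deriv (q : ℕ) (c : ℕ → ℕ → ℝ) (n : ℕ) (y : ℝ) :
    (cpoly q c n).derivative.eval y = pev' q c n y := by
  simp only [cpoly, pev', derivative_sum, eval_finsetSum, derivative_C_mul_X_pow]
  apply Finset.sum_congr rfl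
  intro k _
  simp only [Polynomial.eval_mul, Polynomial.eval_C, Polynomial.eval_pow, Polynomial.eval_X]; ring

lemma sum_prev (N : ℕ) (D : ℕ → ℝ) :
    ∑ n ∈ Finset.range N, D (if n = 0 then N - 1 else n - 1) = ∑ n ∈ Finset.range N, D n := by
  cases N with
  | zero => simp
  | succ M =>
    rw [Finset.sum_range_succ', Finset.sum_range_succ]
    simp

end DG

theorem stmt_10 (q : ℕ) (hq : 1 ≤ q) :
    ∃ C > (0 : ℝ), ∀ (N : ℕ) (x : ℕ → ℝ), DG.Partition N x →
      ∀ w : ℕ → ℝ → ℝ,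
        (∀ n < N, ContDiffOn ℝ 1 (w n) (Set.Icc (x n) (x (n + 1)))) →
      ∀ p : ℕ → ℕ → ℝ,
        (∀ Ψ : ℕ → ℕ → ℝ,
          (∑ n ∈ Finset.range N,
            ∫ y in (x n)..(x (n + 1)), (DG.pev q p n y - w n y) * DG.pev q Ψ n y) = 0) →
        DG.dGsq q N x p ≤ C * DG.dGsqPC N x w := by
  obtain ⟨K, hK, H⟩ := DG.cell q
  refine ⟨13*K+3, by positivity, ?_⟩
  rintro N x ⟨hN, hx0, hxN, hx⟩ w hw p horth
  set D : ℕ → ℝ := fun n => ∫ y in (x n)..(x (n + 1)),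
        (derivWithin (w n) (Set.Icc (x n) (x (n + 1))) y) ^ 2 with hDdef
  have hD : ∀ n < N, 0 ≤ D n := fun n hn =>
    intervalIntegral.integral_nonneg (hx n hn).le fun s _ => sq_nonneg _
  have hcell : ∀ n < N, (∫ y in (x n)..(x (n+1)), (DG.pev' q p n y)^2) ≤ K * D n ∧
      ∀ y ∈ Icc (x n) (x (n+1)), (DG.pev q p n y - w n y)^2 ≤ K * (DG.hseg x n * D n) := by
    intro n hn
    have := H (w n) (x n) (x (n+1)) (hx n hn) (hw n hn) (DG.cpoly q p n) (DG.cpoly_deg q p n) ?_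
    · simp only [DG.cpoly_eval, DG.cpoly_deriv] at this
      exact this
    · intro Q hQ
      have h0 := horth (fun m k => if m = n then Q.coeff k else 0)
      have e1 : ∀ y, DG.pev q (fun m k => if m = n then Q.coeff k else 0) n y = Q.eval y := by
        intro y
        rw [Polynomial.eval_eq_sum_range' (n := q+1) (by omega)]
        simp [DG.pev]
      rw [Finset.sum_eq_single n] at h0
      · simpa only [e1, DG.cpoly_eval] using h0
      · intro m _ hm
        simp [DG.pev, hm]
      · intro h; exact absurd (Finset.mem_range.2 hn) h
  let pr : ℕ → ℕ := fun n => if n = 0 then N - 1 else n - 1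
  have hpr : ∀ n < N, pr n < N := by
    intro n hn; simp only [pr]; split_ifs <;> omega
  have hterm : ∀ n < N,
      (∫ y in (x n)..(x (n + 1)), (DG.pev' q p n y) ^ 2)
      + 2 * (DG.jmp q N x p n) ^ 2 / (DG.hprev N x n + DG.hseg x n)
      ≤ K * D n + 3 * (2 * (DG.jmpPC N x w n) ^ 2 / (DG.hprev N x n + DG.hseg x n))
        + 6 * K * (D (pr n) + D n) := by
    intro n hn
    have hp1 : DG.hprev N x n = DG.hseg x (pr n) := by
      simp only [DG.hprev, pr]; split_ifs <;> rfl
    have hxp : 0 < DG.hseg x (pr n) := sub_pos.2 (hx _ (hpr n hn))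
    have hxn : 0 < DG.hseg x n := sub_pos.2 (hx _ hn)
    have hR := (hcell n hn).2 (x n) ⟨le_rfl, (hx n hn).le⟩
    have hL := (hcell (pr n) (hpr n hn)).2 (x (pr n + 1)) ⟨(hx _ (hpr n hn)).le, le_rfl⟩
    have hj : DG.jmp q N x p n = DG.jmpPC N x w n
        + (DG.pev q p (pr n) (x (pr n + 1)) - w (pr n) (x (pr n + 1)))
        - (DG.pev q p n (x n) - w n (x n)) := by
      simp only [DG.jmp, DG.jmpPC, DG.valL, DG.valR, pr]
      split_ifs with h
      · rw [Nat.sub_add_cancel (by omega : 1 ≤ N)]; ring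
      · rw [Nat.sub_add_cancel (by omega : 1 ≤ n)]; ring
    have h1 := (hcell n hn).1
    have hDn := hD n hn
    have hDp := hD _ (hpr n hn)
    rw [hp1, hj]
    generalize DG.pev q p (pr n) (x (pr n + 1)) - w (pr n) (x (pr n + 1)) = eL at *
    generalize DG.pev q p n (x n) - w n (x n) = eR at *
    generalize DG.jmpPC N x w n = j at *
    generalize DG.hseg x (pr n) = a at *
    generalize DG.hseg x n = b at *
    generalize D (pr n) = dp at *
    generalize D n = dn at *
    have hs : 0 < a + b := by positivity
    have h2 : 2 * (j + eL - eR)^2/(a+b) ≤ 3 * (2*j^2/(a+b)) + 6*K*(dp+dn) := by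
      rw [div_le_iff₀ hs]
      have e : (3 * (2*j^2/(a+b)) + 6*K*(dp+dn))*(a+b) = 6*j^2 + 6*K*(dp+dn)*(a+b) := by
        field_simp; ring
      rw [e]
      have h3 : (j + eL - eR)^2 ≤ 3*(j^2+eL^2+eR^2) := by
        nlinarith [sq_nonneg (j-eL), sq_nonneg (j+eR), sq_nonneg (eL+eR)]
      have h4 : 0 ≤ K * (dp*b) := by positivity
      have h5 : 0 ≤ K * (dn*a) := by positivity
      nlinarith
    linarith
  have hJ : ∀ n < N, 0 ≤ 2 * (DG.jmpPC N x w n) ^ 2 / (DG.hprev N x n + DG.hseg x n) := by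
    intro n hn
    have hp1 : DG.hprev N x n = DG.hseg x (pr n) := by
      simp only [DG.hprev, pr]; split_ifs <;> rfl
    have hxp : 0 < DG.hseg x (pr n) := sub_pos.2 (hx _ (hpr n hn))
    have hxn : 0 < DG.hseg x n := sub_pos.2 (hx _ hn)
    rw [hp1]; positivity
  have hsum := Finset.sum_le_sum (fun n hn => hterm n (Finset.mem_range.1 hn))
  have hSD : 0 ≤ ∑ n ∈ Finset.range N, D n :=
    Finset.sum_nonneg fun n hn => hD n (Finset.mem_range.1 hn)
  have hSJ : 0 ≤ ∑ n ∈ Finset.range N,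
      2 * (DG.jmpPC N x w n) ^ 2 / (DG.hprev N x n + DG.hseg x n) :=
    Finset.sum_nonneg fun n hn => hJ n (Finset.mem_range.1 hn)
  have hpsum : ∑ n ∈ Finset.range N, D (pr n) = ∑ n ∈ Finset.range N, D n := DG.sum_prev N D
  unfold DG.dGsq DG.dGsqPC
  refine hsum.trans ?_
  rw [Finset.sum_add_distrib, Finset.sum_add_distrib, ← Finset.mul_sum, ← Finset.mul_sum,
    ← Finset.mul_sum, Finset.sum_add_distrib, hpsum, Finset.sum_add_distrib]
  change _ ≤ (13*K+3) * (∑ n ∈ Finset.range N, D n + _)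
  have := mul_nonneg hK.le hSJ
  nlinarith
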